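/- There exists a constant δ > 0 such that for every P ≥ 1, every λ ∈ (0,1], every μ ∈ (0,1], and every continuous P-periodic function φ : ℝ → ℝ that solves the steady Whitham equation with wave speed μ, is even, strictly increasing on (−P/2, 0), infinitely differentiable on ℝ ∖ Pℤ, and satisfies μ − 1 ≤ φ(x) ≤ φ(0) = λμ/2 for all x, one has μ/2 − φ(x) ≥ δ·|x|^{1/2} for all x with |x| ≤ δ. -/

import Mathlib

open Real Filter MeasureTheory

/-- The Whitham symbol `m(ξ) = √(tanh ξ / ξ)`, with `m 0 = 1`. -/
noncomputable def whithamSymbol (ξ : ℝ) : ℝ :=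
  if ξ = 0 then 1 else Real.sqrt (Real.tanh ξ / ξ)

/-- The Whitham kernel, defined for `x ≠ 0` as the improper integral
`K(x) = (1/π)·lim_{R→∞} ∫₀^R m(ξ) cos(xξ) dξ`, and `K 0 = 0`. -/
noncomputable def whithamKernel (x : ℝ) : ℝ :=
  if x = 0 then 0 else
    limUnder atTop
      (fun R : ℝ => (1 / Real.pi) * ∫ ξ in (0:ℝ)..R, whithamSymbol ξ * Real.cos (x * ξ))

/-- The convolution operator `Lf(x) = ∫_ℝ K(x−y) f(y) dy`. -/
noncomputable def Lop (K f : ℝ → ℝ) (x : ℝ) : ℝ := ∫ y : ℝ, K (x - y) * f y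

/-! ### The analytic extension of the symbol to the right half-plane -/

theorem Complex.re_cosh (z : ℂ) : (Complex.cosh z).re = Real.cosh z.re * Real.cos z.im := by
  conv_lhs => rw [← Complex.re_add_im z]
  rw [Complex.cosh_add, Complex.cosh_mul_I, Complex.sinh_mul_I]
  simp [← Complex.ofReal_cosh, ← Complex.ofReal_sinh, ← Complex.ofReal_cos, ← Complex.ofReal_sin]

theorem Complex.im_cosh (z : ℂ) : (Complex.cosh z).im = Real.sinh z.re * Real.sin z.im := by
  conv_lhs => rw [← Complex.re_add_im z]
  rw [Complex.cosh_add, Complex.cosh_mul_I, Complex.sinh_mul_I]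
  simp [← Complex.ofReal_cosh, ← Complex.ofReal_sinh, ← Complex.ofReal_cos, ← Complex.ofReal_sin]

theorem Complex.re_sinh (z : ℂ) : (Complex.sinh z).re = Real.sinh z.re * Real.cos z.im := by
  conv_lhs => rw [← Complex.re_add_im z]
  rw [Complex.sinh_add, Complex.cosh_mul_I, Complex.sinh_mul_I]
  simp [← Complex.ofReal_cosh, ← Complex.ofReal_sinh, ← Complex.ofReal_cos, ← Complex.ofReal_sin]

theorem Complex.im_sinh (z : ℂ) : (Complex.sinh z).im = Real.cosh z.re * Real.sin z.im := by
  conv_lhs => rw [← Complex.re_add_im z]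
  rw [Complex.sinh_add, Complex.cosh_mul_I, Complex.sinh_mul_I]
  simp [← Complex.ofReal_cosh, ← Complex.ofReal_sinh, ← Complex.ofReal_cos, ← Complex.ofReal_sin]

theorem Complex.norm_cosh_sq (z : ℂ) :
    ‖Complex.cosh z‖ ^ 2 = Real.sinh z.re ^ 2 + Real.cos z.im ^ 2 := by
  rw [← Complex.normSq_eq_norm_sq, Complex.normSq_apply, Complex.re_cosh, Complex.im_cosh]
  linear_combination Real.cos z.im ^ 2 * Real.cosh_sq z.re
    + Real.sinh z.re ^ 2 * Real.sin_sq_add_cos_sq z.im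

theorem Complex.norm_sinh_sq (z : ℂ) :
    ‖Complex.sinh z‖ ^ 2 = Real.sinh z.re ^ 2 + Real.sin z.im ^ 2 := by
  rw [← Complex.normSq_eq_norm_sq, Complex.normSq_apply, Complex.re_sinh, Complex.im_sinh]
  linear_combination Real.sin z.im ^ 2 * Real.cosh_sq z.re
    + Real.sinh z.re ^ 2 * Real.sin_sq_add_cos_sq z.im

theorem Complex.cosh_ne_zero_of_re_pos {z : ℂ} (hz : 0 < z.re) : Complex.cosh z ≠ 0 := by
  intro h
  have h1 := Complex.norm_cosh_sq z
  rw [h, norm_zero] at h1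
  have : 0 < Real.sinh z.re := Real.sinh_pos_iff.2 hz
  nlinarith [sq_nonneg (Real.cos z.im)]

theorem Complex.tanh_re_pos {z : ℂ} (hz : 0 < z.re) : 0 < (Complex.tanh z).re := by
  have hs : 0 < Real.sinh z.re := Real.sinh_pos_iff.2 hz
  have hc : 0 < Real.cosh z.re := Real.cosh_pos _
  have hn : 0 < Complex.normSq (Complex.cosh z) :=
    Complex.normSq_pos.2 (Complex.cosh_ne_zero_of_re_pos hz)
  rw [Complex.tanh_eq_sinh_div_cosh, Complex.div_re, ← add_div, Complex.re_cosh, Complex.im_cosh,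
    Complex.re_sinh, Complex.im_sinh]
  refine div_pos ?_ hn
  have : Real.sinh z.re * Real.cos z.im * (Real.cosh z.re * Real.cos z.im)
      + Real.cosh z.re * Real.sin z.im * (Real.sinh z.re * Real.sin z.im)
      = Real.sinh z.re * Real.cosh z.re := by
    linear_combination (Real.sinh z.re * Real.cosh z.re) * Real.sin_sq_add_cos_sq z.im
  rw [this]
  positivity

theorem Complex.ofReal_mul_cpow {t : ℝ} (ht : 0 < t) {w : ℂ} (hw : w ≠ 0) (r : ℝ) :
    (t * w : ℂ) ^ (r : ℂ) = ((t ^ r : ℝ) : ℂ) * w ^ (r : ℂ) := by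
  have ht' : (t : ℂ) ≠ 0 := Complex.ofReal_ne_zero.2 ht.ne'
  rw [Complex.ofReal_cpow ht.le, Complex.cpow_def_of_ne_zero (mul_ne_zero ht' hw),
    Complex.cpow_def_of_ne_zero ht', Complex.cpow_def_of_ne_zero hw, Complex.log_ofReal_mul ht hw,
    Complex.ofReal_log ht.le, ← Complex.exp_add, add_mul]

/-- The analytic extension `√(tanh z) / √z` of the Whitham symbol to the right half-plane. -/
noncomputable def whithamExt (z : ℂ) : ℂ :=
  Complex.tanh z ^ ((1 / 2 : ℝ) : ℂ) * z ^ ((-(1 / 2) : ℝ) : ℂ)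

theorem differentiableAt_whithamExt {z : ℂ} (hz : 0 < z.re) :
    DifferentiableAt ℂ whithamExt z := by
  have ht : DifferentiableAt ℂ Complex.tanh z := by
    have : Complex.tanh = fun w => Complex.sinh w / Complex.cosh w :=
      funext Complex.tanh_eq_sinh_div_cosh
    rw [this]
    exact Complex.differentiable_sinh.differentiableAt.div
      Complex.differentiable_cosh.differentiableAt (Complex.cosh_ne_zero_of_re_pos hz)
  exact (ht.cpow_const (Or.inl (Complex.tanh_re_pos hz))).mul
    (differentiableAt_id.cpow_const (Or.inl hz))

theorem whithamExt_ofReal {ξ : ℝ} (hξ : 0 < ξ) : whithamExt ξ = whithamSymbol ξ := by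
  have ht : 0 < Real.tanh ξ := by
    rw [Real.tanh_eq_sinh_div_cosh]
    exact div_pos (Real.sinh_pos_iff.2 hξ) (Real.cosh_pos _)
  rw [whithamExt, whithamSymbol, if_neg hξ.ne', ← Complex.ofReal_tanh,
    ← Complex.ofReal_cpow ht.le, ← Complex.ofReal_cpow hξ.le, ← Complex.ofReal_mul,
    Real.sqrt_eq_rpow, Real.div_rpow ht.le hξ.le, Real.rpow_neg hξ.le, ← div_eq_mul_inv]

theorem norm_whithamExt_sq {z : ℂ} : ‖whithamExt z‖ ^ 2 = ‖Complex.tanh z‖ / ‖z‖ := by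
  have h0 := norm_nonneg (Complex.tanh z)
  rw [whithamExt, norm_mul, Complex.norm_cpow_real, Complex.norm_cpow_real, mul_pow,
    ← Real.rpow_mul_natCast h0, ← Real.rpow_mul_natCast (norm_nonneg z)]
  norm_num [Real.rpow_neg_one, div_eq_mul_inv]

theorem norm_whithamExt_sq_le_of_one_le_re {z : ℂ} (hz : 1 ≤ z.re) :
    ‖whithamExt z‖ ^ 2 ≤ 2 / z.re := by
  have hs : 1 ≤ Real.sinh z.re := hz.trans (Real.self_le_sinh_iff.2 (by linarith))
  have hc : 0 < ‖Complex.cosh z‖ :=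
    norm_pos_iff.2 (Complex.cosh_ne_zero_of_re_pos (by linarith))
  have ht : ‖Complex.tanh z‖ ≤ 2 := by
    rw [Complex.tanh_eq_sinh_div_cosh, norm_div, div_le_iff₀ hc]
    refine abs_le_of_sq_le_sq' ?_ (by positivity) |>.2
    rw [mul_pow, Complex.norm_sinh_sq, Complex.norm_cosh_sq]
    nlinarith [Real.sin_sq_le_one z.im, sq_nonneg (Real.cos z.im)]
  rw [norm_whithamExt_sq]
  exact div_le_div₀ zero_le_two ht (by linarith) (Complex.re_le_norm z)

theorem norm_whithamExt_sq_le {z : ℂ} (h0 : 0 < z.re) (h1 : z.re ≤ 1)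
    (hc : Real.cos z.im ≠ 0) : ‖whithamExt z‖ ^ 2 ≤ 2 / |Real.cos z.im| := by
  have hz : 0 < ‖z‖ := h0.trans_le (Complex.re_le_norm z)
  have hsinh : ‖Complex.sinh z‖ ≤ 2 * ‖z‖ := by
    refine abs_le_of_sq_le_sq' ?_ (by positivity) |>.2
    have hs : Real.sinh z.re ≤ 2 * z.re := by
      have h := Real.abs_exp_sub_one_sub_id_le (x := z.re) (by rw [abs_of_pos h0]; exact h1)
      have h' := Real.abs_exp_sub_one_sub_id_le (x := -z.re)
        (by rw [abs_neg, abs_of_pos h0]; exact h1)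
      rw [Real.sinh_eq]
      nlinarith [(abs_le.1 h).2, (abs_le.1 h').1]
    have hs0 : 0 < Real.sinh z.re := Real.sinh_pos_iff.2 h0
    have hb : Real.sin z.im ^ 2 ≤ z.im ^ 2 := by
      rw [← sq_abs, ← sq_abs z.im]
      exact pow_le_pow_left₀ (abs_nonneg _) Real.abs_sin_le_abs 2
    rw [Complex.norm_sinh_sq, mul_pow, ← Complex.normSq_eq_norm_sq, Complex.normSq_apply]
    nlinarith
  have hcosh : |Real.cos z.im| ≤ ‖Complex.cosh z‖ := by
    refine abs_le_of_sq_le_sq' ?_ (by positivity) |>.2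
    rw [Complex.norm_cosh_sq, sq_abs]
    nlinarith [sq_nonneg (Real.sinh z.re)]
  rw [norm_whithamExt_sq, Complex.tanh_eq_sinh_div_cosh, norm_div, div_div]
  have hc' : 0 < |Real.cos z.im| := abs_pos.2 hc
  rw [div_le_div_iff₀ (mul_pos (hc'.trans_le hcosh) hz) hc']
  calc ‖Complex.sinh z‖ * |Real.cos z.im| ≤ 2 * ‖z‖ * ‖Complex.cosh z‖ := by gcongr
    _ = _ := by ring

theorem norm_whithamExt_sq_le_inv_norm {z : ℂ} (hs : Real.sin z.im = 0) :
    ‖whithamExt z‖ ^ 2 ≤ 1 / ‖z‖ := by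
  rw [norm_whithamExt_sq, Complex.tanh_eq_sinh_div_cosh, norm_div]
  gcongr
  refine div_le_one_of_le₀ ?_ (norm_nonneg _)
  refine abs_le_of_sq_le_sq' ?_ (by positivity) |>.2
  rw [Complex.norm_sinh_sq, Complex.norm_cosh_sq, hs]
  nlinarith [sq_nonneg (Real.cos z.im)]

/-- Up to the factor `1 / π`, the density of the representation of the Whitham kernel as a
superposition of exponentials. It vanishes where `tan s ≥ 0`. -/
noncomputable def whithamDensity (s : ℝ) : ℝ := Real.sqrt (-Real.tan s / s)

theorem whithamExt_mul_I {s : ℝ} (hs : 0 < s) (hsin : Real.sin s ≠ 0)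
    (hcos : Real.cos s ≠ 0) :
    (whithamExt (s * Complex.I)).im = -whithamDensity s ∧
      ContinuousAt whithamExt (s * Complex.I) := by
  have ht : Real.tan s ≠ 0 := by
    rw [Real.tan_eq_sin_div_cos]; exact div_ne_zero hsin hcos
  have htan : Complex.tanh (s * Complex.I) = Real.tan s * Complex.I := by
    rw [Complex.tanh_mul_I, Complex.ofReal_tan]
  refine ⟨?_, ?_⟩
  · have hI : (s * Complex.I) ^ ((-(1 / 2) : ℝ) : ℂ)
        = ((s ^ (-(1 / 2) : ℝ) : ℝ) : ℂ) * Complex.exp (-(π / 4 * Complex.I)) := by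
      rw [Complex.ofReal_mul_cpow hs Complex.I_ne_zero,
        Complex.cpow_def_of_ne_zero Complex.I_ne_zero, Complex.log_I]
      congr 2; push_cast; ring
    rw [whithamExt, htan, hI, whithamDensity]
    rcases ht.lt_or_gt with h | h
    · have : (Real.tan s * Complex.I : ℂ) = ((-Real.tan s : ℝ) : ℂ) * (-Complex.I) := by
        push_cast; ring
      rw [this, Complex.ofReal_mul_cpow (by linarith) (neg_ne_zero.2 Complex.I_ne_zero),
        Complex.cpow_def_of_ne_zero (neg_ne_zero.2 Complex.I_ne_zero), Complex.log_neg_I]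
      have h2 : Complex.exp (-(π / 2) * Complex.I * ((1 / 2 : ℝ) : ℂ))
          * Complex.exp (-(π / 4 * Complex.I)) = -Complex.I := by
        rw [← Complex.exp_add, ← Complex.exp_neg_pi_div_two_mul_I]
        congr 1; push_cast; ring
      rw [mul_mul_mul_comm, h2, ← Complex.ofReal_mul, Real.sqrt_eq_rpow,
        Real.div_rpow (by linarith) hs.le, Real.rpow_neg hs.le]
      simp only [Complex.mul_im, Complex.ofReal_re, Complex.ofReal_im, Complex.neg_im, Complex.I_im,
        zero_mul, add_zero, mul_neg_one, div_eq_mul_inv]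
    · rw [Complex.ofReal_mul_cpow h Complex.I_ne_zero,
        Complex.cpow_def_of_ne_zero Complex.I_ne_zero, Complex.log_I]
      have h2 : Complex.exp (π / 2 * Complex.I * ((1 / 2 : ℝ) : ℂ))
          * Complex.exp (-(π / 4 * Complex.I)) = 1 := by
        rw [← Complex.exp_add, ← Complex.exp_zero]
        congr 1; push_cast; ring
      rw [mul_mul_mul_comm, h2, ← Complex.ofReal_mul,
        Real.sqrt_eq_zero_of_nonpos (div_nonpos_of_nonpos_of_nonneg (by linarith) hs.le)]
      simp
  · have hcosh : Complex.cosh (s * Complex.I) ≠ 0 := by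
      rw [Complex.cosh_mul_I, ← Complex.ofReal_cos]
      exact_mod_cast hcos
    have h1 : ContinuousAt Complex.tanh (s * Complex.I) := by
      have : Complex.tanh = fun w => Complex.sinh w / Complex.cosh w :=
        funext Complex.tanh_eq_sinh_div_cosh
      rw [this]
      exact Complex.continuous_sinh.continuousAt.div Complex.continuous_cosh.continuousAt hcosh
    refine ((continuousAt_cpow_const (Or.inr ?_)).comp h1).mul
      ((continuousAt_cpow_const (Or.inr ?_)).comp continuousAt_id)
    · rw [htan, Complex.im_ofReal_mul, Complex.I_im, mul_one]; exact ht
    · simpa using hs.ne'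

/-! ### Integrability of the density -/

theorem lintegral_Ioi_periodic_mul_antitone_le {T : ℝ} (hT : 0 < T) {p g : ℝ → ENNReal}
    (hpm : Measurable p) (hp : Function.Periodic p T) (hg : AntitoneOn g (Set.Ici 0)) :
    ∫⁻ s in Set.Ioi 0, p s * g s ≤ (∫⁻ s in Set.Ioc 0 T, p s) * ∑' n : ℕ, g (n * T) := by
  have hcover : Set.Ioi (0 : ℝ) ⊆ ⋃ n : ℕ, Set.Ioc (n * T) (n * T + T) := by
    intro s hs
    obtain ⟨n, hn⟩ : ∃ n : ℕ, n + 1 = ⌈s / T⌉₊ :=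
      ⟨_, Nat.sub_add_cancel (Nat.one_le_ceil_iff.2 (div_pos hs hT))⟩
    refine Set.mem_iUnion.2 ⟨n, ?_, ?_⟩
    · have : (n : ℝ) < s / T := Nat.lt_ceil.1 (by omega)
      exact (lt_div_iff₀ hT).1 this
    · have : s / T ≤ (n + 1 : ℕ) := hn ▸ Nat.le_ceil _
      rw [div_le_iff₀ hT] at this
      push_cast at this
      linarith
  have hshift (n : ℕ) : ∫⁻ s in Set.Ioc (n * T) (n * T + T), p s = ∫⁻ s in Set.Ioc 0 T, p s := by
    have h := (measurePreserving_add_right (volume : Measure ℝ) (n * T)).setLIntegral_comp_preimage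
      (measurableSet_Ioc (a := n * T) (b := n * T + T)) hpm
    rw [← h]
    have hset : (fun s => s + n * T) ⁻¹' Set.Ioc (n * T) (n * T + T) = Set.Ioc 0 T := by
      ext s; simp [add_comm (n * T) T]
    rw [hset]
    exact lintegral_congr fun s => hp.nat_mul n s
  calc ∫⁻ s in Set.Ioi 0, p s * g s
      ≤ ∫⁻ s in ⋃ n : ℕ, Set.Ioc (n * T) (n * T + T), p s * g s := lintegral_mono_set hcover
    _ ≤ ∑' n : ℕ, ∫⁻ s in Set.Ioc (n * T) (n * T + T), p s * g s := lintegral_iUnion_le _ _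
    _ ≤ ∑' n : ℕ, (∫⁻ s in Set.Ioc 0 T, p s) * g (n * T) := by
        refine ENNReal.tsum_le_tsum fun n => ?_
        rw [← hshift n, ← lintegral_mul_const _ hpm]
        refine setLIntegral_mono' measurableSet_Ioc fun s hs => ?_
        have h0 : (0 : ℝ) ≤ n * T := by positivity
        gcongr
        exact hg h0 (h0.trans hs.1.le) hs.1.le
    _ = _ := ENNReal.tsum_mul_left

theorem measurable_sqrt_inv_abs_cos : Measurable fun s : ℝ => Real.sqrt (1 / |Real.cos s|) := by
  fun_prop

theorem lintegral_sqrt_inv_abs_cos_lt_top :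
    ∫⁻ s in Set.Ioc 0 π, ENNReal.ofReal (Real.sqrt (1 / |Real.cos s|)) < ⊤ := by
  have h1 : IntervalIntegrable (fun t : ℝ => t ^ (-(1 / 2) : ℝ)) volume (-(π / 2)) (π / 2) :=
    intervalIntegral.intervalIntegrable_rpow' (by norm_num)
  have h2 : IntervalIntegrable (fun t : ℝ => (-t) ^ (-(1 / 2) : ℝ)) volume (-(π / 2)) (π / 2) := by
    have := (IntervalIntegrable.iff_comp_neg (by simp)).1
      (intervalIntegral.intervalIntegrable_rpow' (r := -(1 / 2)) (a := π / 2) (b := -(π / 2))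
        (by norm_num))
    simpa using this
  have h3 := (((h1.add h2).const_mul (Real.sqrt (π / 2))).comp_sub_right (π / 2)).norm
  have h4 : IntegrableOn _ (Set.Ioc 0 π) :=
    (intervalIntegrable_iff_integrableOn_Ioc_of_le Real.pi_pos.le).1
      (by convert h3 using 1 <;> ring)
  refine lt_of_le_of_lt (setLIntegral_mono' measurableSet_Ioc fun s hs => ?_) h4.2
  have hnn (t : ℝ) : 0 ≤ t ^ (-(1 / 2) : ℝ) ∨ t < 0 := by
    rcases le_or_gt 0 t with h | h
    · exact Or.inl (Real.rpow_nonneg h _)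
    · exact Or.inr h
  have hneg (t : ℝ) (ht : t < 0) : t ^ (-(1 / 2) : ℝ) = 0 := by
    rw [Real.rpow_def_of_neg ht, show -(1 / 2) * π = -(π / 2) by ring, Real.cos_neg,
      Real.cos_pi_div_two, mul_zero]
  have key : Real.sqrt (1 / |Real.cos s|) ≤ Real.sqrt (π / 2) *
      ((s - π / 2) ^ (-(1 / 2) : ℝ) + (-(s - π / 2)) ^ (-(1 / 2) : ℝ)) := by
    have hval : (s - π / 2) ^ (-(1 / 2) : ℝ) + (-(s - π / 2)) ^ (-(1 / 2) : ℝ) =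
        Real.sqrt (1 / |s - π / 2|) ∨ s = π / 2 := by
      have hpos (t : ℝ) (ht : 0 < t) :
          t ^ (-(1 / 2) : ℝ) = Real.sqrt (1 / t) := by
        rw [Real.rpow_neg ht.le, ← Real.sqrt_eq_rpow, one_div, Real.sqrt_inv]
      rcases lt_trichotomy s (π / 2) with h | h | h
      · left
        rw [hneg _ (by linarith), hpos _ (by linarith), zero_add, abs_of_neg (by linarith)]
      · exact Or.inr h
      · left
        rw [hneg (-(s - π / 2)) (by linarith), hpos _ (by linarith), add_zero,
          abs_of_pos (by linarith)]
    rcases hval with hval | rfl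
    · rw [hval, ← Real.sqrt_mul (by positivity)]
      refine Real.sqrt_le_sqrt ?_
      have hs' : |s - π / 2| ≤ π / 2 := abs_le.2 ⟨by linarith [hs.1], by linarith [hs.2]⟩
      have h := Real.mul_abs_le_abs_sin hs'
      rw [Real.sin_sub_pi_div_two, abs_neg] at h
      rcases eq_or_ne s (π / 2) with rfl | hne
      · simp
      have hp : 0 < |s - π / 2| := abs_pos.2 (sub_ne_zero.2 hne)
      have hm : 0 < 2 / π * |s - π / 2| := by positivity
      calc 1 / |Real.cos s| ≤ 1 / (2 / π * |s - π / 2|) := one_div_le_one_div_of_le hm h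
        _ = _ := by field_simp
    · simp
  have hr : 0 ≤ Real.sqrt (1 / |Real.cos s|) := Real.sqrt_nonneg _
  rw [← Real.enorm_of_nonneg hr]
  refine enorm_le_iff_norm_le.2 ?_
  rw [Real.norm_of_nonneg hr, norm_norm]
  exact key.trans (le_abs_self _)

theorem integrableOn_sqrt_inv_abs_cos_mul {g : ℝ → ℝ} (hgm : Measurable g)
    (hg : AntitoneOn g (Set.Ici 0)) (hg0 : ∀ s, 0 ≤ s → 0 ≤ g s)
    (hgs : Summable fun n : ℕ => g (n * π)) :
    IntegrableOn (fun s => Real.sqrt (1 / |Real.cos s|) * g s) (Set.Ioi 0) := by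
  refine ⟨(measurable_sqrt_inv_abs_cos.mul hgm).aestronglyMeasurable, ?_⟩
  have hper : Function.Periodic (fun s => ENNReal.ofReal (Real.sqrt (1 / |Real.cos s|))) π := by
    intro s
    simp [Real.cos_add_pi]
  have h := lintegral_Ioi_periodic_mul_antitone_le Real.pi_pos
    measurable_sqrt_inv_abs_cos.ennreal_ofReal hper (g := fun s => ENNReal.ofReal (g s))
    (fun a ha b hb hab => ENNReal.ofReal_le_ofReal (hg ha hb hab))
  refine lt_of_le_of_lt ?_ (h.trans_lt (ENNReal.mul_lt_top lintegral_sqrt_inv_abs_cos_lt_top ?_))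
  · refine setLIntegral_mono' measurableSet_Ioi fun s hs => ?_
    rw [← ENNReal.ofReal_mul (Real.sqrt_nonneg _),
      Real.enorm_of_nonneg (mul_nonneg (Real.sqrt_nonneg _) (hg0 s (le_of_lt hs)))]
  · rw [← ENNReal.ofReal_tsum_of_nonneg (fun n => hg0 _ (by positivity)) hgs]
    exact ENNReal.ofReal_lt_top

theorem integrableOn_sqrt_inv_abs_cos_mul_exp {x : ℝ} (hx : 0 < x) :
    IntegrableOn (fun s => Real.sqrt (1 / |Real.cos s|) * Real.exp (-x * s)) (Set.Ioi 0) := by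
  refine integrableOn_sqrt_inv_abs_cos_mul (by fun_prop) ?_ (fun s _ => (Real.exp_pos _).le) ?_
  · intro a _ b _ hab
    exact Real.exp_le_exp.2 (by nlinarith)
  · have h : (fun n : ℕ => Real.exp (-x * (n * π))) = fun n : ℕ => Real.exp (-x * π) ^ n := by
      ext n
      rw [← Real.exp_nat_mul]
      ring_nf
    rw [h]
    exact summable_geometric_of_lt_one (Real.exp_pos _).le
      (Real.exp_lt_one_iff.2 (by nlinarith [Real.pi_pos]))

theorem measurable_whithamDensity : Measurable whithamDensity := by
  unfold whithamDensity
  simp only [Real.tan_eq_sin_div_cos]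
  fun_prop

theorem whithamDensity_nonneg (s : ℝ) : 0 ≤ whithamDensity s := Real.sqrt_nonneg _

theorem whithamDensity_le {s : ℝ} (hs : 0 < s) :
    whithamDensity s ≤ Real.sqrt (1 / |Real.cos s|) * Real.sqrt (2 / (1 + s)) := by
  rw [whithamDensity, ← Real.sqrt_mul (by positivity)]
  refine Real.sqrt_le_sqrt ?_
  rcases lt_or_ge s 1 with h | h
  · have ht : 0 ≤ Real.tan s :=
      Real.tan_nonneg_of_nonneg_of_le_pi_div_two hs.le (by linarith [Real.pi_gt_three])
    exact (div_nonpos_of_nonpos_of_nonneg (by linarith) hs.le).trans (by positivity)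
  · rw [Real.tan_eq_sin_div_cos, div_eq_mul_one_div]
    gcongr ?_ * ?_
    · refine (neg_le_abs _).trans ?_
      rw [abs_div]
      gcongr
      exact Real.abs_sin_le_one s
    · rw [div_le_div_iff₀ hs (by positivity)]
      linarith

theorem integrableOn_whithamDensity_div :
    IntegrableOn (fun s => whithamDensity s / s) (Set.Ioi 0) := by
  have hg : IntegrableOn
      (fun s => Real.sqrt (1 / |Real.cos s|) * (2 / (1 + s)) ^ (3 / 2 : ℝ)) (Set.Ioi 0) := by
    refine integrableOn_sqrt_inv_abs_cos_mul (by fun_prop) ?_ (fun s hs => by positivity) ?_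
    · intro a ha b hb hab
      have ha' : (0 : ℝ) ≤ a := ha
      have hb' : (0 : ℝ) ≤ b := hb
      dsimp only
      gcongr
    · have hsum : Summable fun n : ℕ => 2 ^ (3 / 2 : ℝ) * (1 / ((n : ℝ) + 1) ^ (3 / 2 : ℝ)) := by
        have := (summable_nat_add_iff 1).2
          (Real.summable_one_div_nat_rpow (p := 3 / 2).2 (by norm_num))
        exact (by simpa using this : Summable _).mul_left _
      refine hsum.of_nonneg_of_le (fun n => by positivity) fun n => ?_
      rw [← div_eq_mul_one_div, ← Real.div_rpow zero_le_two (by positivity)]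
      have hn : (n : ℝ) ≤ n * π :=
        le_mul_of_one_le_right n.cast_nonneg (by linarith [Real.pi_gt_three])
      have : 2 / (1 + n * π) ≤ 2 / ((n : ℝ) + 1) := by
        gcongr 2 / ?_
        linarith
      gcongr
  refine hg.mono' (measurable_whithamDensity.div measurable_id).aestronglyMeasurable ?_
  refine (ae_restrict_iff' measurableSet_Ioi).2 (ae_of_all _ fun s hs => ?_)
  have hs' : (0 : ℝ) < s := hs
  rw [Real.norm_of_nonneg (div_nonneg (whithamDensity_nonneg s) hs'.le)]
  rcases lt_or_ge s 1 with h | h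
  · have ht : 0 ≤ Real.tan s :=
      Real.tan_nonneg_of_nonneg_of_le_pi_div_two hs'.le (by linarith [Real.pi_gt_three])
    rw [whithamDensity,
      Real.sqrt_eq_zero_of_nonpos (div_nonpos_of_nonpos_of_nonneg (by linarith) hs'.le), zero_div]
    positivity
  · have h2 : 0 < 2 / (1 + s) := by positivity
    rw [show (3 / 2 : ℝ) = 1 / 2 + 1 by norm_num, Real.rpow_add_one h2.ne', ← Real.sqrt_eq_rpow,
      ← mul_assoc, div_eq_mul_one_div]
    gcongr ?_ * ?_
    · exact whithamDensity_le hs'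
    · rw [div_le_div_iff₀ hs' (by positivity)]
      linarith

/-! ### The kernel as a superposition of exponentials -/

/-- The integrand `whithamExt z * exp (i x z)` of the contour integral for the kernel. -/
noncomputable def whithamWave (x : ℝ) (z : ℂ) : ℂ := whithamExt z * Complex.exp (Complex.I * x * z)

theorem norm_whithamWave (x : ℝ) (z : ℂ) :
    ‖whithamWave x z‖ = ‖whithamExt z‖ * Real.exp (-x * z.im) := by
  rw [whithamWave, norm_mul, Complex.norm_exp]
  simp

theorem differentiableAt_whithamWave (x : ℝ) {z : ℂ} (hz : 0 < z.re) :
    DifferentiableAt ℂ (whithamWave x) z :=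
  (differentiableAt_whithamExt hz).mul (by fun_prop)

theorem continuous_whithamWave_vertical (x : ℝ) {a : ℝ} (ha : 0 < a) :
    Continuous fun y : ℝ => whithamWave x (a + y * Complex.I) := by
  refine continuous_iff_continuousAt.2 fun y => ?_
  have h : ContinuousAt (whithamWave x) (a + y * Complex.I) :=
    (differentiableAt_whithamWave x (by simpa using ha)).continuousAt
  exact ContinuousAt.comp (f := fun y : ℝ => (a + y * Complex.I : ℂ)) h (by fun_prop)

theorem norm_whithamWave_le_of_one_le (x : ℝ) {R : ℝ} (hR : 1 ≤ R) (y : ℝ) :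
    ‖whithamWave x (R + y * Complex.I)‖ ≤ Real.sqrt (2 / R) * Real.exp (-x * y) := by
  have h := norm_whithamExt_sq_le_of_one_le_re (z := R + y * Complex.I) (by simpa using hR)
  rw [norm_whithamWave]
  simp only [Complex.add_re, Complex.ofReal_re, Complex.mul_re, Complex.I_re, mul_zero,
    Complex.ofReal_im, Complex.I_im, mul_one, sub_self, add_zero] at h
  simp only [Complex.add_im, Complex.ofReal_im, Complex.mul_im, Complex.ofReal_re, Complex.I_im,
    mul_one, Complex.I_re, mul_zero, add_zero, zero_add]
  gcongr
  exact Real.le_sqrt_of_sq_le h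

theorem norm_whithamWave_le (x : ℝ) {ε : ℝ} (h0 : 0 < ε) (h1 : ε ≤ 1) {y : ℝ}
    (hy : Real.cos y ≠ 0) :
    ‖whithamWave x (ε + y * Complex.I)‖ ≤
      Real.sqrt 2 * (Real.sqrt (1 / |Real.cos y|) * Real.exp (-x * y)) := by
  have h := norm_whithamExt_sq_le (z := ε + y * Complex.I) (by simpa using h0) (by simpa using h1)
    (by simpa using hy)
  rw [norm_whithamWave]
  simp only [Complex.add_im, Complex.ofReal_im, Complex.mul_im, Complex.ofReal_re, Complex.I_im,
    mul_one, Complex.I_re, mul_zero, add_zero, zero_add] at h ⊢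
  rw [← mul_assoc, ← Real.sqrt_mul zero_le_two, ← div_eq_mul_one_div]
  gcongr
  exact Real.le_sqrt_of_sq_le h

theorem ae_sin_ne_zero_and_cos_ne_zero : ∀ᵐ s : ℝ, Real.sin s ≠ 0 ∧ Real.cos s ≠ 0 := by
  have hs : {s : ℝ | Real.sin s = 0}.Countable :=
    (Set.countable_range fun n : ℤ => (n : ℝ) * π).mono fun s hs => Real.sin_eq_zero_iff.1 hs
  have hc : {s : ℝ | Real.cos s = 0}.Countable :=
    (Set.countable_range fun n : ℤ => (2 * (n : ℝ) + 1) * π / 2).mono fun s hs => by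
      obtain ⟨k, hk⟩ := Real.cos_eq_zero_iff.1 hs
      exact ⟨k, hk.symm⟩
  filter_upwards [hs.ae_notMem volume, hc.ae_notMem volume] with s h1 h2 using ⟨h1, h2⟩

theorem integrableOn_whithamWave_of_one_le {x : ℝ} (hx : 0 < x) {R : ℝ} (hR : 1 ≤ R) :
    IntegrableOn (fun y : ℝ => whithamWave x (R + y * Complex.I)) (Set.Ioi 0) :=
  ((exp_neg_integrableOn_Ioi 0 hx).const_mul _).mono'
    (continuous_whithamWave_vertical x (by linarith)).aestronglyMeasurable
    (ae_of_all _ (norm_whithamWave_le_of_one_le x hR))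

theorem integrableOn_whithamWave {x : ℝ} (hx : 0 < x) {ε : ℝ} (h0 : 0 < ε) (h1 : ε ≤ 1) :
    IntegrableOn (fun y : ℝ => whithamWave x (ε + y * Complex.I)) (Set.Ioi 0) :=
  ((integrableOn_sqrt_inv_abs_cos_mul_exp hx).const_mul _).mono'
    (continuous_whithamWave_vertical x h0).aestronglyMeasurable
    (ae_restrict_of_ae (ae_sin_ne_zero_and_cos_ne_zero.mono fun _ hy =>
      norm_whithamWave_le x h0 h1 hy.2))

theorem integral_whithamWave_contour {x : ℝ} (hx : 0 < x) {ε R : ℝ} (h0 : 0 < ε) (h1 : ε ≤ 1)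
    (hR : 1 ≤ R) :
    (∫ ξ : ℝ in ε..R, whithamWave x ξ)
      + Complex.I * (∫ y : ℝ in Set.Ioi 0, whithamWave x (R + y * Complex.I))
      - Complex.I * (∫ y : ℝ in Set.Ioi 0, whithamWave x (ε + y * Complex.I)) = 0 := by
  have hpi : Tendsto (fun n : ℕ => (n : ℝ) * π) atTop atTop :=
    tendsto_natCast_atTop_atTop.atTop_mul_const Real.pi_pos
  have hright := (intervalIntegral_tendsto_integral_Ioi 0
    (integrableOn_whithamWave_of_one_le hx hR) hpi).const_mul Complex.I
  have hleft := (intervalIntegral_tendsto_integral_Ioi 0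
    (integrableOn_whithamWave hx h0 h1) hpi).const_mul Complex.I
  have htop : Tendsto (fun n : ℕ => ∫ ξ : ℝ in ε..R, whithamWave x (ξ + (n * π : ℝ) * Complex.I))
      atTop (nhds 0) := by
    have hexp : Tendsto (fun n : ℕ => Real.sqrt (1 / ε) * Real.exp (-x * (n * π)) * |R - ε|) atTop
        (nhds 0) := by
      have : Tendsto (fun n : ℕ => Real.exp (-x * (n * π))) atTop (nhds 0) :=
        Real.tendsto_exp_atBot.comp (hpi.const_mul_atTop_of_neg (by linarith))
      simpa using (this.const_mul (Real.sqrt (1 / ε))).mul_const |R - ε|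
    refine squeeze_zero_norm (fun n => ?_) hexp
    refine intervalIntegral.norm_integral_le_of_norm_le_const fun ξ hξ => ?_
    rw [Set.uIoc_of_le (h1.trans hR)] at hξ
    have hre : ((ξ : ℂ) + (n * π : ℝ) * Complex.I).re = ξ := by simp
    have him : ((ξ : ℂ) + (n * π : ℝ) * Complex.I).im = n * π := by simp
    have h := norm_whithamExt_sq_le_inv_norm (z := ξ + (n * π : ℝ) * Complex.I)
      (by rw [him]; exact Real.sin_nat_mul_pi n)
    rw [norm_whithamWave, him]
    gcongr
    refine Real.le_sqrt_of_sq_le (h.trans (one_div_le_one_div_of_le h0 ?_))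
    exact (hξ.1.le.trans_eq hre.symm).trans (Complex.re_le_norm _)
  have hrect (n : ℕ) : (∫ ξ : ℝ in ε..R, whithamWave x ξ)
      - (∫ ξ : ℝ in ε..R, whithamWave x (ξ + (n * π : ℝ) * Complex.I))
      + Complex.I * (∫ y : ℝ in (0 : ℝ)..n * π, whithamWave x (R + y * Complex.I))
      - Complex.I * (∫ y : ℝ in (0 : ℝ)..n * π, whithamWave x (ε + y * Complex.I)) = 0 := by
    have h := Complex.integral_boundary_rect_eq_zero_of_differentiableOn (whithamWave x)
      ⟨ε, 0⟩ ⟨R, n * π⟩ (fun z hz => (differentiableAt_whithamWave x (by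
        have := (Complex.mem_reProdIm.1 hz).1
        rw [Set.uIcc_of_le (h1.trans hR)] at this
        exact h0.trans_le this.1)).differentiableWithinAt)
    simpa using h
  have hlim := ((tendsto_const_nhds (x := ∫ ξ : ℝ in ε..R, whithamWave x ξ)).sub htop).add
    hright |>.sub hleft
  rw [sub_zero] at hlim
  exact tendsto_nhds_unique hlim
    ((tendsto_const_nhds (x := (0 : ℂ))).congr fun n => (hrect n).symm)

theorem whithamWave_mul_I (x s : ℝ) :
    whithamWave x (s * Complex.I) = whithamExt (s * Complex.I) * Real.exp (-x * s) := by
  rw [whithamWave, Complex.ofReal_exp]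
  congr 2
  push_cast
  linear_combination (x * s : ℂ) * Complex.I_mul_I

theorem whithamWave_ofReal (x : ℝ) {ξ : ℝ} (hξ : 0 < ξ) :
    whithamWave x ξ = whithamSymbol ξ * Complex.exp ((x * ξ : ℝ) * Complex.I) := by
  rw [whithamWave, whithamExt_ofReal hξ]
  congr 2
  push_cast
  ring

theorem intervalIntegrable_whithamWave (x : ℝ) {R : ℝ} (hR : 0 ≤ R) :
    IntervalIntegrable (fun ξ : ℝ => whithamWave x ξ) volume 0 R := by
  rw [intervalIntegrable_iff_integrableOn_Ioc_of_le hR]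
  refine ⟨?_, .restrict_of_bounded (C := Real.sqrt 2) measure_Ioc_lt_top ?_⟩
  · refine ContinuousOn.aestronglyMeasurable (fun ξ hξ => ?_) measurableSet_Ioc
    have h : ContinuousAt (whithamWave x) ξ :=
      (differentiableAt_whithamWave x (by simpa using hξ.1)).continuousAt
    exact (ContinuousAt.comp (f := fun ξ : ℝ => (ξ : ℂ)) h (by fun_prop)).continuousWithinAt
  · refine (ae_restrict_iff' measurableSet_Ioc).2 (ae_of_all _ fun ξ hξ => ?_)
    rcases le_total ξ 1 with h | h
    · simpa using norm_whithamWave_le x hξ.1 h (y := 0) (by simp)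
    · have h2 := norm_whithamWave_le_of_one_le x h 0
      simp only [Complex.ofReal_zero, zero_mul, add_zero, mul_zero, Real.exp_zero, mul_one] at h2
      exact h2.trans (Real.sqrt_le_sqrt (div_le_self zero_le_two h))

theorem ae_tendsto_whithamWave (x : ℝ) : ∀ᵐ s : ℝ ∂volume.restrict (Set.Ioi 0),
    Tendsto (fun ε : ℝ => whithamWave x (ε + s * Complex.I)) (nhdsWithin 0 (Set.Ioi 0))
      (nhds (whithamWave x (s * Complex.I))) := by
  refine (ae_restrict_iff' measurableSet_Ioi).2 ?_
  filter_upwards [ae_sin_ne_zero_and_cos_ne_zero] with s hs hs0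
  have hc : ContinuousAt (whithamWave x) (s * Complex.I) :=
    (whithamExt_mul_I hs0 hs.1 hs.2).2.mul (by fun_prop)
  have hline : Tendsto (fun ε : ℝ => (ε + s * Complex.I : ℂ)) (nhdsWithin 0 (Set.Ioi 0))
      (nhds (s * Complex.I)) := by
    have : Continuous (fun ε : ℝ => (ε + s * Complex.I : ℂ)) := by fun_prop
    simpa using (this.tendsto 0).mono_left nhdsWithin_le_nhds
  exact hc.tendsto.comp hline

theorem integrableOn_whithamWave_mul_I {x : ℝ} (hx : 0 < x) :
    IntegrableOn (fun y : ℝ => whithamWave x (y * Complex.I)) (Set.Ioi 0) := by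
  have hpos (n : ℕ) : 0 < 1 / ((n : ℝ) + 1) := by positivity
  refine ((integrableOn_sqrt_inv_abs_cos_mul_exp hx).const_mul (Real.sqrt 2)).mono' ?_ ?_
  · have hseq : Tendsto (fun n : ℕ => 1 / ((n : ℝ) + 1)) atTop (nhdsWithin 0 (Set.Ioi 0)) :=
      tendsto_nhdsWithin_iff.2 ⟨tendsto_one_div_add_atTop_nhds_zero_nat, Eventually.of_forall hpos⟩
    exact aestronglyMeasurable_of_tendsto_ae atTop
      (fun n => (continuous_whithamWave_vertical x (hpos n)).aestronglyMeasurable)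
      ((ae_tendsto_whithamWave x).mono fun s hs => hs.comp hseq)
  · filter_upwards [ae_tendsto_whithamWave x, ae_restrict_of_ae ae_sin_ne_zero_and_cos_ne_zero]
      with s hs hsc
    refine le_of_tendsto hs.norm ?_
    filter_upwards [Ioc_mem_nhdsGT (zero_lt_one (α := ℝ))] with ε hε
    exact norm_whithamWave_le x hε.1 hε.2 hsc.2

theorem integral_whithamWave_real {x : ℝ} (hx : 0 < x) {R : ℝ} (hR : 1 ≤ R) :
    (∫ ξ : ℝ in (0 : ℝ)..R, whithamWave x ξ)
      + Complex.I * (∫ y : ℝ in Set.Ioi 0, whithamWave x (R + y * Complex.I))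
      - Complex.I * (∫ y : ℝ in Set.Ioi 0, whithamWave x (y * Complex.I)) = 0 := by
  have hR0 : 0 < R := by linarith
  have hsmall : ∀ᶠ ε : ℝ in nhdsWithin 0 (Set.Ioi 0), 0 < ε ∧ ε ≤ 1 :=
    Ioc_mem_nhdsGT zero_lt_one
  have hreal : Tendsto (fun ε : ℝ => ∫ ξ : ℝ in ε..R, whithamWave x ξ)
      (nhdsWithin 0 (Set.Ioi 0)) (nhds (∫ ξ : ℝ in (0 : ℝ)..R, whithamWave x ξ)) := by
    have h := intervalIntegral.continuousOn_primitive_interval_left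
      (a := 0) (b := R) (μ := volume) (f := fun ξ : ℝ => whithamWave x ξ)
      (by
        rw [Set.uIcc_of_le hR0.le, integrableOn_Icc_iff_integrableOn_Ioc,
          ← intervalIntegrable_iff_integrableOn_Ioc_of_le hR0.le]
        exact intervalIntegrable_whithamWave x hR0.le)
    refine (h 0 Set.left_mem_uIcc).tendsto.mono_left (nhdsWithin_le_of_mem ?_)
    rw [Set.uIcc_of_le hR0.le]
    exact Icc_mem_nhdsGT hR0
  have hleft : Tendsto (fun ε : ℝ => ∫ y : ℝ in Set.Ioi 0, whithamWave x (ε + y * Complex.I))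
      (nhdsWithin 0 (Set.Ioi 0)) (nhds (∫ y : ℝ in Set.Ioi 0, whithamWave x (y * Complex.I))) := by
    refine tendsto_integral_filter_of_dominated_convergence _ ?_ ?_
      ((integrableOn_sqrt_inv_abs_cos_mul_exp hx).const_mul (Real.sqrt 2)) ?_
    · filter_upwards [hsmall] with ε hε
      exact (continuous_whithamWave_vertical x hε.1).aestronglyMeasurable
    · filter_upwards [hsmall] with ε hε
      exact ae_restrict_of_ae (ae_sin_ne_zero_and_cos_ne_zero.mono fun y hy =>
        norm_whithamWave_le x hε.1 hε.2 hy.2)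
    · exact ae_tendsto_whithamWave x
  have hlim := (hreal.add_const (Complex.I *
    (∫ y : ℝ in Set.Ioi 0, whithamWave x (R + y * Complex.I)))).sub (hleft.const_mul Complex.I)
  refine tendsto_nhds_unique hlim ((tendsto_const_nhds (x := (0 : ℂ))).congr' ?_)
  filter_upwards [hsmall] with ε hε
  exact (integral_whithamWave_contour hx hε.1 hε.2 hR).symm

theorem integral_whithamSymbol_mul_cos {x : ℝ} (hx : 0 < x) {R : ℝ} (hR : 1 ≤ R) :
    (∫ ξ in (0 : ℝ)..R, whithamSymbol ξ * Real.cos (x * ξ)) =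
      (∫ s in Set.Ioi 0, whithamDensity s * Real.exp (-x * s))
        + (∫ y : ℝ in Set.Ioi 0, whithamWave x (R + y * Complex.I)).im := by
  have hR0 : 0 ≤ R := by linarith
  have h := congrArg Complex.re (integral_whithamWave_real hx hR)
  have hre : (∫ ξ : ℝ in (0 : ℝ)..R, whithamWave x ξ).re
      = ∫ ξ in (0 : ℝ)..R, whithamSymbol ξ * Real.cos (x * ξ) := by
    rw [← Complex.reCLM_apply,
      ← Complex.reCLM.intervalIntegral_comp_comm (intervalIntegrable_whithamWave x hR0)]
    refine intervalIntegral.integral_congr_ae (ae_of_all _ fun ξ hξ => ?_)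
    rw [Set.uIoc_of_le hR0] at hξ
    rw [Complex.reCLM_apply, whithamWave_ofReal x hξ.1, Complex.re_ofReal_mul,
      Complex.exp_ofReal_mul_I_re]
  have him : (∫ y : ℝ in Set.Ioi 0, whithamWave x (y * Complex.I)).im
      = -∫ s in Set.Ioi 0, whithamDensity s * Real.exp (-x * s) := by
    have hae : ∀ᵐ s : ℝ ∂volume.restrict (Set.Ioi 0),
        (whithamWave x (s * Complex.I)).im = -(whithamDensity s * Real.exp (-x * s)) := by
      refine (ae_restrict_iff' measurableSet_Ioi).2 ?_
      filter_upwards [ae_sin_ne_zero_and_cos_ne_zero] with s hs hs0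
      rw [whithamWave_mul_I, Complex.im_mul_ofReal, (whithamExt_mul_I hs0 hs.1 hs.2).1, neg_mul]
    rw [← Complex.imCLM_apply, ← Complex.imCLM.integral_comp_comm (integrableOn_whithamWave_mul_I hx),
      ← integral_neg]
    exact integral_congr_ae hae
  simp only [Complex.sub_re, Complex.add_re, Complex.mul_re, Complex.I_re, Complex.I_im, zero_mul,
    one_mul, zero_sub, Complex.zero_re, hre, him] at h
  linarith

theorem whithamKernel_of_pos {x : ℝ} (hx : 0 < x) :
    whithamKernel x = 1 / π * ∫ s in Set.Ioi 0, whithamDensity s * Real.exp (-x * s) := by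
  rw [whithamKernel, if_neg hx.ne']
  refine Tendsto.limUnder_eq (Tendsto.const_mul _ ?_)
  have herr : Tendsto (fun R : ℝ => (∫ y : ℝ in Set.Ioi 0, whithamWave x (R + y * Complex.I)).im)
      atTop (nhds 0) := by
    have hb : Tendsto (fun R : ℝ => Real.sqrt (2 / R) * ∫ y in Set.Ioi 0, Real.exp (-x * y)) atTop
        (nhds 0) := by
      have h2 : Tendsto (fun R : ℝ => 2 / R) atTop (nhds 0) := tendsto_const_nhds.div_atTop tendsto_id
      simpa using (h2.sqrt).mul_const (∫ y in Set.Ioi 0, Real.exp (-x * y))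
    refine squeeze_zero_norm' ?_ hb
    filter_upwards [eventually_ge_atTop 1] with R hR
    refine (Complex.abs_im_le_norm _).trans ?_
    rw [← integral_const_mul]
    exact norm_integral_le_of_norm_le ((exp_neg_integrableOn_Ioi 0 hx).const_mul _)
      (ae_of_all _ (norm_whithamWave_le_of_one_le x hR))
  have h := herr.const_add (∫ s in Set.Ioi 0, whithamDensity s * Real.exp (-x * s))
  rw [add_zero] at h
  refine h.congr' ?_
  filter_upwards [eventually_ge_atTop 1] with R hR
  exact (integral_whithamSymbol_mul_cos hx hR).symm

theorem whithamKernel_eq {x : ℝ} (hx : x ≠ 0) :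
    whithamKernel x = 1 / π * ∫ s in Set.Ioi 0, whithamDensity s * Real.exp (-s * |x|) := by
  have habs : whithamKernel x = whithamKernel |x| := by
    simp only [whithamKernel, abs_eq_zero]
    congr! 6 with _ _ _ ξ
    rw [← Real.cos_abs (x * ξ), ← Real.cos_abs (|x| * ξ), abs_mul, abs_mul, abs_abs]
  rw [habs, whithamKernel_of_pos (abs_pos.2 hx)]
  congr 2 with s
  ring_nf

/-! ### Lower bounds for the density -/

theorem le_sqrt_neg_tan (s : ℝ) :
    (Real.sin (2 * s) ^ 2 - Real.sin (2 * s)) / 4 ≤ Real.sqrt (-Real.tan s) := by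
  rcases le_or_gt 0 (Real.sin (2 * s)) with h | h
  · refine le_trans ?_ (Real.sqrt_nonneg _)
    nlinarith [Real.sin_le_one (2 * s)]
  have hcos : Real.cos s ≠ 0 := fun h0 => by simp [Real.sin_two_mul, h0] at h
  have hneg := Real.neg_one_le_sin (2 * s)
  have htan : Real.tan s * Real.cos s ^ 2 = Real.sin (2 * s) / 2 := by
    rw [Real.tan_eq_sin_div_cos, Real.sin_two_mul]; field_simp
  have hc : Real.cos s ^ 2 ≤ 1 := Real.cos_sq_le_one s
  have hc0 : 0 < Real.cos s ^ 2 := by positivity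
  have htan0 : Real.tan s < 0 := by
    by_contra! h0
    nlinarith [mul_nonneg h0 hc0.le]
  have h1 : -Real.sin (2 * s) / 2 ≤ -Real.tan s := by nlinarith
  calc _ ≤ -Real.sin (2 * s) / 2 := by nlinarith
    _ ≤ _ := Real.le_sqrt_of_sq_le (by nlinarith)

theorem le_whithamDensity {s B : ℝ} (hs : 0 < s) (hB : s ≤ B) :
    (Real.sin (2 * s) ^ 2 - Real.sin (2 * s)) / 4 / Real.sqrt B ≤ whithamDensity s := by
  have hsB : 0 < Real.sqrt s := Real.sqrt_pos.2 hs
  have hle : Real.sqrt s ≤ Real.sqrt B := Real.sqrt_le_sqrt hB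
  unfold whithamDensity
  rw [Real.sqrt_div' _ hs.le]
  calc _ ≤ Real.sqrt (-Real.tan s) / Real.sqrt B := by gcongr; exact le_sqrt_neg_tan s
    _ ≤ _ := by gcongr

theorem le_integral_sin_sq_sub_sin {A : ℝ} (hA : 5 ≤ A) :
    A / 16 ≤ ∫ s in A..2 * A, (Real.sin (2 * s) ^ 2 - Real.sin (2 * s)) / 4 := by
  have hderiv : ∀ s : ℝ, HasDerivAt
      (fun s => (s / 2 - Real.sin (4 * s) / 8 + Real.cos (2 * s) / 2) / 4)
      ((Real.sin (2 * s) ^ 2 - Real.sin (2 * s)) / 4) s := fun s => by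
    have h2 : HasDerivAt (fun s : ℝ => 2 * s) (2 * 1) s := (hasDerivAt_id s).const_mul 2
    have h4 : HasDerivAt (fun s : ℝ => 4 * s) (4 * 1) s := (hasDerivAt_id s).const_mul 4
    have h := ((((hasDerivAt_id s).div_const 2).sub (h4.sin.div_const 8)).add
      (h2.cos.div_const 2)).div_const 4
    refine h.congr_deriv ?_
    rw [show 4 * s = 2 * (2 * s) by ring, Real.cos_two_mul', Real.cos_sq']
    ring
  rw [intervalIntegral.integral_eq_sub_of_hasDerivAt (fun s _ => hderiv s)
    (Continuous.intervalIntegrable (by fun_prop) _ _)]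
  linarith [Real.sin_le_one (4 * (2 * A)), Real.neg_one_le_sin (4 * A),
    Real.neg_one_le_cos (2 * (2 * A)), Real.cos_le_one (2 * A)]

/-! ### Exponential convolutions of odd periodic functions -/

theorem integrableOn_exp_mul_of_bounded {s M : ℝ} (hs : 0 < s) {g : ℝ → ℝ} (hg : Continuous g)
    (hM : ∀ t, |g t| ≤ M) (a : ℝ) :
    IntegrableOn (fun t => Real.exp (-s * t) * g t) (Set.Ioi a) :=
  (integrableOn_exp_mul_Ioi (neg_neg_of_pos hs) a).mul_bdd (c := M) hg.aestronglyMeasurable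
    (ae_of_all _ hM)

theorem integral_Ioi_exp_mul_periodic {s P M : ℝ} (hs : 0 < s) (hP : 0 < P) {g : ℝ → ℝ}
    (hg : Continuous g) (hper : Function.Periodic g P) (hM : ∀ t, |g t| ≤ M) :
    ∫ t in Set.Ioi 0, Real.exp (-s * t) * g t =
      (∫ t in (0 : ℝ)..P, Real.exp (-s * t) * g t) / (1 - Real.exp (-s * P)) := by
  have hint := integrableOn_exp_mul_of_bounded hs hg hM
  have hshift : ∫ t in Set.Ioi P, Real.exp (-s * t) * g t =
      Real.exp (-s * P) * ∫ t in Set.Ioi 0, Real.exp (-s * t) * g t := by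
    have h := (measurePreserving_add_right volume P).setIntegral_preimage_emb
      (measurableEmbedding_addRight P) (fun t => Real.exp (-s * t) * g t) (Set.Ioi P)
    rw [← h, ← integral_const_mul]
    simp only [Set.preimage_add_const_Ioi, sub_self]
    refine setIntegral_congr_fun measurableSet_Ioi fun t _ => ?_
    simp only [hper t]
    rw [mul_add, Real.exp_add]; ring
  have hsplit := intervalIntegral.integral_interval_add_Ioi (hint 0) (hint P)
  have hq : Real.exp (-s * P) < 1 := Real.exp_lt_one_iff.2 (by nlinarith)
  rw [eq_div_iff (by linarith)]
  linarith

/-- Up to the factor `1 - exp (-s * P)`, the periodization of `exp (-s * |·|)` over `P`. -/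
noncomputable def periodizedExp (s P t : ℝ) : ℝ := Real.exp (-s * t) + Real.exp (-s * (P - t))

theorem continuous_periodizedExp (s P : ℝ) : Continuous (periodizedExp s P) := by
  unfold periodizedExp; fun_prop

theorem periodizedExp_sub_eq (s P u v : ℝ) : periodizedExp s P u - periodizedExp s P v =
    (Real.exp (-s * u) - Real.exp (-s * v)) * (1 - Real.exp (-s * (P - u - v))) := by
  simp only [periodizedExp, mul_sub, sub_mul, ← Real.exp_add, mul_one]
  ring_nf

theorem periodizedExp_le {s P u v : ℝ} (hs : 0 ≤ s) (huv : u ≤ v) (hP : u + v ≤ P) :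
    periodizedExp s P v ≤ periodizedExp s P u := by
  rw [← sub_nonneg, periodizedExp_sub_eq]
  refine mul_nonneg (sub_nonneg.2 (Real.exp_le_exp.2 (by nlinarith)))
    (sub_nonneg.2 (Real.exp_le_one_iff.2 (by nlinarith)))

theorem integral_exp_neg_mul_abs {s : ℝ} (hs : 0 < s) :
    ∫ t, Real.exp (-s * |t|) = 2 / s := by
  rw [integral_comp_abs (f := fun t => Real.exp (-s * t)),
    integral_exp_mul_Ioi (neg_neg_of_pos hs)]
  simp [div_eq_mul_inv]

theorem integrable_exp_neg_mul_abs {s : ℝ} (hs : 0 < s) :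
    Integrable fun t => Real.exp (-s * |t|) :=
  .of_integral_ne_zero (by rw [integral_exp_neg_mul_abs hs]; positivity)

theorem integral_exp_abs_mul_eq_Ioi {s M : ℝ} (hs : 0 < s) {D : ℝ → ℝ} (hD : Continuous D)
    (hM : ∀ t, |D t| ≤ M) (x : ℝ) :
    ∫ y, Real.exp (-s * |x - y|) * D y =
      ∫ t in Set.Ioi 0, Real.exp (-s * t) * (D (x + t) + D (x - t)) := by
  have h1 := integrableOn_exp_mul_of_bounded hs (g := fun t => D (x + t)) (by fun_prop)
    (fun t => hM _) 0
  have h2 := integrableOn_exp_mul_of_bounded hs (g := fun t => D (x - t)) (by fun_prop)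
    (fun t => hM _) 0
  have hint : Integrable fun t => Real.exp (-s * |t|) * D (x + t) :=
    (integrable_exp_neg_mul_abs hs).mul_bdd (c := M) (by fun_prop) (ae_of_all _ fun t => hM _)
  calc _ = ∫ t, Real.exp (-s * |t|) * D (x + t) := by
        rw [← integral_add_left_eq_self _ x]
        simp [abs_neg]
    _ = (∫ t in Set.Iic 0, Real.exp (-s * |t|) * D (x + t)) +
        ∫ t in Set.Ioi 0, Real.exp (-s * |t|) * D (x + t) := by
        rw [intervalIntegral.integral_Iic_add_Ioi hint.integrableOn hint.integrableOn]
    _ = _ := by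
        simp only [mul_add]
        rw [integral_add h1 h2, add_comm]
        congr 1
        · refine setIntegral_congr_fun measurableSet_Ioi fun t ht => ?_
          simp only [abs_of_pos (show (0 : ℝ) < t from ht)]
        · rw [← neg_zero, ← integral_comp_neg_Ioi, neg_zero]
          refine setIntegral_congr_fun measurableSet_Ioi fun t ht => ?_
          simp only [abs_neg, abs_of_pos (show (0 : ℝ) < t from ht), sub_eq_add_neg]

/-- For an odd periodic function, convolution with a decaying exponential reduces to an integral
over half a period. -/
theorem integral_exp_abs_mul_eq_half_period {s P M : ℝ} (hs : 0 < s) (hP : 0 < P) {D : ℝ → ℝ}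
    (hD : Continuous D) (hper : Function.Periodic D P) (hodd : ∀ t, D (-t) = -D t)
    (hM : ∀ t, |D t| ≤ M) {x : ℝ}
    (hx : x ∈ Set.Icc (-(P / 2)) 0) :
    ∫ y, Real.exp (-s * |x - y|) * D y =
      (∫ y in (-(P / 2))..0,
        (periodizedExp s P |x - y| - periodizedExp s P (-x - y)) * D y) /
        (1 - Real.exp (-s * P)) := by
  have hc := continuous_periodizedExp s P
  have hrefl : ∀ t, periodizedExp s P (P - t) = periodizedExp s P t := fun t => by
    simp only [periodizedExp, sub_sub_cancel, add_comm]
  rw [integral_exp_abs_mul_eq_Ioi hs hD hM, integral_Ioi_exp_mul_periodic (M := M + M) hs hP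
    (by fun_prop)]
  rotate_left
  · intro t
    simp only [← add_assoc, ← sub_sub, hper _, hper.sub_eq]
  · exact fun t => (abs_add_le _ _).trans (add_le_add (hM _) (hM _))
  congr 1
  have hii : ∀ {f : ℝ → ℝ} (_ : Continuous f) (a b : ℝ), IntervalIntegrable f volume a b :=
    fun hf a b => hf.intervalIntegrable a b
  have hcomb : ∫ t in (0 : ℝ)..P, Real.exp (-s * t) * (D (x + t) + D (x - t)) =
      ∫ y in x..x + P, periodizedExp s P (y - x) * D y := by
    have h : ∫ t in (0 : ℝ)..P, Real.exp (-s * t) * D (x - t) =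
        ∫ t in (0 : ℝ)..P, Real.exp (-s * (P - t)) * D (x + t) := by
      have := intervalIntegral.integral_comp_sub_left (a := 0) (b := P)
        (fun t => Real.exp (-s * t) * D (x - t)) P
      rw [sub_self, sub_zero] at this
      rw [← this]
      refine intervalIntegral.integral_congr fun t _ => ?_
      rw [show x - (P - t) = x + t - P by ring, hper.sub_eq]
    have h' := intervalIntegral.integral_comp_add_left (a := 0) (b := P)
        (fun y => periodizedExp s P (y - x) * D y) x
    rw [add_zero] at h'
    simp only [mul_add]
    rw [← h', intervalIntegral.integral_add (hii (by fun_prop) _ _) (hii (by fun_prop) _ _), h,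
      ← intervalIntegral.integral_add (hii (by fun_prop) _ _) (hii (by fun_prop) _ _)]
    refine intervalIntegral.integral_congr fun t _ => ?_
    simp only [periodizedExp, add_sub_cancel_left]
    ring
  have h2 : ∫ y in (0 : ℝ)..P / 2, periodizedExp s P (y - x) * D y =
      -∫ y in (-(P / 2))..0, periodizedExp s P (-x - y) * D y := by
    have := intervalIntegral.integral_comp_neg (a := -(P / 2)) (b := 0)
      (fun y => periodizedExp s P (y - x) * D y)
    rw [neg_neg, neg_zero] at this
    rw [← this, ← intervalIntegral.integral_neg]
    refine intervalIntegral.integral_congr fun t _ => ?_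
    rw [hodd, show -t - x = -x - t by ring, mul_neg]
  have h3 : ∫ y in P / 2..x + P, periodizedExp s P (y - x) * D y =
      ∫ y in (-(P / 2))..x, periodizedExp s P |x - y| * D y := by
    have := intervalIntegral.integral_comp_add_right (a := -(P / 2)) (b := x)
      (fun y => periodizedExp s P (y - x) * D y) P
    rw [show -(P / 2) + P = P / 2 by ring] at this
    rw [← this]
    refine intervalIntegral.integral_congr fun t ht => ?_
    rw [Set.uIcc_of_le hx.1] at ht
    rw [hper t, abs_of_nonneg (sub_nonneg.2 ht.2), ← hrefl, show P - (t + P - x) = x - t by ring]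
  have h1 : ∫ y in x..0, periodizedExp s P (y - x) * D y =
      ∫ y in x..0, periodizedExp s P |x - y| * D y := by
    refine intervalIntegral.integral_congr fun t ht => ?_
    rw [Set.uIcc_of_le hx.2] at ht
    rw [abs_sub_comm, abs_of_nonneg (sub_nonneg.2 ht.1)]
  have hH : Continuous fun y => periodizedExp s P (y - x) * D y := by fun_prop
  have hH' : Continuous fun y => periodizedExp s P |x - y| * D y := by fun_prop
  rw [hcomb, ← intervalIntegral.integral_add_adjacent_intervals (hii hH x 0) (hii hH 0 _),
    ← intervalIntegral.integral_add_adjacent_intervals (hii hH 0 (P / 2)) (hii hH _ _), h1, h2, h3]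
  simp only [sub_mul]
  rw [intervalIntegral.integral_sub (hii hH' _ _) (hii (by fun_prop) _ _),
    ← intervalIntegral.integral_add_adjacent_intervals (hii hH' (-(P / 2)) x) (hii hH' x 0)]
  ring

theorem periodizedExp_reflect_le {s P x y : ℝ} (hs : 0 ≤ s) (hx : x ∈ Set.Icc (-(P / 2)) 0)
    (hy : y ∈ Set.Icc (-(P / 2)) 0) :
    periodizedExp s P (-x - y) ≤ periodizedExp s P |x - y| := by
  obtain ⟨hx1, hx2⟩ := hx
  obtain ⟨hy1, hy2⟩ := hy
  refine periodizedExp_le hs (abs_le.2 ⟨by linarith, by linarith⟩) ?_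
  rcases abs_cases (x - y) with h | h <;> linarith

theorem integral_exp_abs_mul_nonneg {s P M : ℝ} (hs : 0 < s) (hP : 0 < P) {D : ℝ → ℝ}
    (hD : Continuous D) (hper : Function.Periodic D P) (hodd : ∀ t, D (-t) = -D t)
    (hM : ∀ t, |D t| ≤ M) (hpos : ∀ t ∈ Set.Icc (-(P / 2)) 0, 0 ≤ D t) {x : ℝ}
    (hx : x ∈ Set.Icc (-(P / 2)) 0) :
    0 ≤ ∫ y, Real.exp (-s * |x - y|) * D y := by
  rw [integral_exp_abs_mul_eq_half_period hs hP hD hper hodd hM hx]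
  refine div_nonneg (intervalIntegral.integral_nonneg (by linarith) fun y hy => ?_)
    (sub_nonneg.2 (Real.exp_le_one_iff.2 (by nlinarith)))
  exact mul_nonneg (sub_nonneg.2 (periodizedExp_reflect_le hs.le hx hy)) (hpos y hy)

theorem one_half_le_one_sub_exp {z : ℝ} (hz : 1 ≤ z) : 1 / 2 ≤ 1 - Real.exp (-z) := by
  have h : Real.exp (-z) ≤ 2⁻¹ := by
    rw [Real.exp_neg]
    gcongr
    linarith [Real.add_one_le_exp z]
  linarith

theorem le_periodizedExp_sub {s P h y : ℝ} (hP : 1 ≤ P) (hh : 0 < h) (hh' : h ≤ 1 / 16)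
    (hs : s * h ∈ Set.Icc (1 : ℝ) 2) (hy : y ∈ Set.Icc (-(4 * h)) (-(2 * h))) :
    1 / 36 ≤ periodizedExp s P |-(3 * h) - y| - periodizedExp s P (- -(3 * h) - y) := by
  obtain ⟨hy1, hy2⟩ := hy
  obtain ⟨hs1, hs2⟩ := hs
  have hs0 : 0 < s := by by_contra! h0; nlinarith
  have hs16 : 16 ≤ s := by nlinarith
  have hu : |-(3 * h) - y| ≤ h := abs_le.2 ⟨by linarith, by linarith⟩
  have huv : |-(3 * h) - y| + (- -(3 * h) - y) ≤ 1 / 2 := by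
    rcases abs_cases (-(3 * h) - y) with h | h <;> linarith
  have hdiff : 1 / 18 ≤
      Real.exp (-s * |-(3 * h) - y|) - Real.exp (-s * (- -(3 * h) - y)) := by
    have h1 : Real.exp (-s * h) ≤ Real.exp (-s * |-(3 * h) - y|) :=
      Real.exp_le_exp.2 (by nlinarith)
    have h2 : Real.exp (-s * (- -(3 * h) - y)) ≤ Real.exp (-s * h) * Real.exp (-(4 * (s * h))) := by
      rw [← Real.exp_add]
      exact Real.exp_le_exp.2 (by nlinarith)
    have h3 : 1 / 9 ≤ Real.exp (-s * h) := by
      have he : Real.exp 2 ≤ 9 := by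
        rw [show (2 : ℝ) = 1 + 1 by norm_num, Real.exp_add]
        nlinarith [Real.exp_one_lt_d9, Real.exp_pos 1]
      calc (1 / 9 : ℝ) ≤ 1 / Real.exp 2 := by gcongr
        _ = Real.exp (-2) := by rw [Real.exp_neg, one_div]
        _ ≤ _ := Real.exp_le_exp.2 (by linarith)
    nlinarith [one_half_le_one_sub_exp (z := 4 * (s * h)) (by linarith)]
  have hfac := one_half_le_one_sub_exp (z := s * (P - |-(3 * h) - y| - (- -(3 * h) - y)))
    (by nlinarith)
  rw [periodizedExp_sub_eq, neg_mul s (P - _ - _)]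
  nlinarith

theorem le_integral_exp_abs_mul {s P M h : ℝ} (hP : 1 ≤ P) (hh : 0 < h) (hh' : h ≤ 1 / 16)
    (hs : s * h ∈ Set.Icc (1 : ℝ) 2) {D : ℝ → ℝ}
    (hD : Continuous D) (hper : Function.Periodic D P) (hodd : ∀ t, D (-t) = -D t)
    (hM : ∀ t, |D t| ≤ M) (hpos : ∀ t ∈ Set.Icc (-(P / 2)) 0, 0 ≤ D t) :
    1 / 36 * ∫ y in (-(4 * h))..(-(2 * h)), D y ≤
      ∫ y, Real.exp (-s * |-(3 * h) - y|) * D y := by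
  have hs0 : 0 < s := by by_contra! h0; nlinarith [hs.1]
  have hx : -(3 * h) ∈ Set.Icc (-(P / 2)) 0 := ⟨by linarith, by linarith⟩
  have hc := continuous_periodizedExp s P
  have hsub : ∀ y ∈ Set.Icc (-(4 * h)) (-(2 * h)), 0 ≤ D y := fun y hy =>
    hpos y ⟨by linarith [hy.1], by linarith [hy.2]⟩
  rw [integral_exp_abs_mul_eq_half_period hs0 (by linarith) hD hper hodd hM hx,
    le_div_iff₀ (sub_pos.2 (Real.exp_lt_one_iff.2 (by nlinarith)))]
  calc _ ≤ 1 / 36 * ∫ y in (-(4 * h))..(-(2 * h)), D y := by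
        refine mul_le_of_le_one_right
          (mul_nonneg (by norm_num) (intervalIntegral.integral_nonneg (by linarith) hsub)) ?_
        linarith [Real.exp_pos (-s * P)]
    _ = ∫ y in (-(4 * h))..(-(2 * h)), 1 / 36 * D y :=
        (intervalIntegral.integral_const_mul _ _).symm
    _ ≤ ∫ y in (-(4 * h))..(-(2 * h)),
        (periodizedExp s P |-(3 * h) - y| - periodizedExp s P (- -(3 * h) - y)) * D y := by
        refine intervalIntegral.integral_mono_on (by linarith)
          (Continuous.intervalIntegrable (by fun_prop) _ _)
          (Continuous.intervalIntegrable (by fun_prop) _ _) fun y hy => ?_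
        exact mul_le_mul_of_nonneg_right (le_periodizedExp_sub hP hh hh' hs hy) (hsub y hy)
    _ ≤ _ := by
        refine intervalIntegral.integral_mono_interval (by linarith) (by linarith) (by linarith) ?_
          (Continuous.intervalIntegrable (by fun_prop) _ _)
        refine (ae_restrict_iff' measurableSet_Ioc).2 (ae_of_all _ fun y hy => ?_)
        have hy' := Set.Ioc_subset_Icc_self hy
        exact mul_nonneg (sub_nonneg.2 (periodizedExp_reflect_le hs0.le hx hy')) (hpos y hy')

/-! ### Convolution with the Whitham kernel -/

theorem integrable_whithamDensity_mul_exp_abs (x : ℝ) :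
    Integrable (fun p : ℝ × ℝ => whithamDensity p.1 * Real.exp (-p.1 * |x - p.2|))
      ((volume.restrict (Set.Ioi 0)).prod volume) := by
  have hmeas := measurable_whithamDensity
  rw [integrable_prod_iff (by fun_prop)]
  have hs : ∀ᵐ s ∂volume.restrict (Set.Ioi (0 : ℝ)), 0 < s :=
    ae_restrict_mem measurableSet_Ioi
  constructor
  · filter_upwards [hs] with s hs
    exact ((integrable_exp_neg_mul_abs hs).comp_sub_left x).const_mul _
  · refine (integrableOn_whithamDensity_div.const_mul 2).congr ?_
    filter_upwards [hs] with s hs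
    have h : ∀ y, ‖whithamDensity s * Real.exp (-s * |x - y|)‖ =
        whithamDensity s * Real.exp (-s * |x - y|) := fun y =>
      Real.norm_of_nonneg (mul_nonneg (whithamDensity_nonneg s) (Real.exp_pos _).le)
    simp only [h]
    rw [integral_const_mul, integral_sub_left_eq_self (fun t => Real.exp (-s * |t|)),
      integral_exp_neg_mul_abs hs]
    ring

theorem integrable_whithamKernel : Integrable whithamKernel := by
  refine (((integrable_whithamDensity_mul_exp_abs 0).integral_prod_right).const_mul (1 / π)).congr ?_
  filter_upwards [compl_mem_ae_iff.2 (measure_singleton (0 : ℝ))] with x hx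
  simp [whithamKernel_eq hx]

theorem integrable_whithamDensity_mul_exp_abs_mul {D : ℝ → ℝ} {M : ℝ} (hD : Continuous D)
    (hM : ∀ t, |D t| ≤ M) (x : ℝ) :
    Integrable (fun p : ℝ × ℝ => whithamDensity p.1 * Real.exp (-p.1 * |x - p.2|) * D p.2)
      ((volume.restrict (Set.Ioi 0)).prod volume) :=
  (integrable_whithamDensity_mul_exp_abs x).mul_bdd (c := M) (by fun_prop)
    (ae_of_all _ fun p => hM p.2)

theorem integrableOn_whithamDensity_mul_integral {D : ℝ → ℝ} {M : ℝ} (hD : Continuous D)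
    (hM : ∀ t, |D t| ≤ M) (x : ℝ) :
    IntegrableOn (fun s => whithamDensity s * ∫ y, Real.exp (-s * |x - y|) * D y) (Set.Ioi 0) := by
  simpa only [IntegrableOn, mul_assoc, integral_const_mul] using
    (integrable_whithamDensity_mul_exp_abs_mul hD hM x).integral_prod_left

theorem Lop_whithamKernel_eq {D : ℝ → ℝ} {M : ℝ} (hD : Continuous D)
    (hM : ∀ t, |D t| ≤ M) (x : ℝ) :
    Lop whithamKernel D x =
      1 / π * ∫ s in Set.Ioi 0, whithamDensity s * ∫ y, Real.exp (-s * |x - y|) * D y := by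
  have hswap := integral_integral_swap
    (f := fun s y => whithamDensity s * Real.exp (-s * |x - y|) * D y)
    (integrable_whithamDensity_mul_exp_abs_mul hD hM x)
  simp only [mul_assoc, integral_const_mul] at hswap
  rw [hswap, ← integral_const_mul]
  refine integral_congr_ae ?_
  filter_upwards [compl_mem_ae_iff.2 (measure_singleton x)] with y hy
  rw [whithamKernel_eq (sub_ne_zero.2 (Ne.symm hy)), mul_assoc, ← integral_mul_const]
  simp only [mul_assoc]

theorem Lop_whithamKernel_sub {φ : ℝ → ℝ} {M : ℝ} (hφ : Continuous φ) (hM : ∀ t, |φ t| ≤ M)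
    (x h : ℝ) :
    Lop whithamKernel φ (x + h) - Lop whithamKernel φ (x - h) =
      Lop whithamKernel (fun y => φ (y + h) - φ (y - h)) x := by
  have hint : ∀ k : ℝ, Integrable fun y => whithamKernel (x - y) * φ (y + k) := fun k =>
    (integrable_whithamKernel.comp_sub_left x).mul_bdd (c := M) (by fun_prop)
      (ae_of_all _ fun t => hM _)
  have hshift : ∀ k : ℝ, Lop whithamKernel φ (x + k) =
      ∫ y, whithamKernel (x - y) * φ (y + k) := fun k => by
    unfold Lop
    rw [← integral_add_right_eq_self _ k]
    simp only [add_sub_add_right_eq_sub]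
  have h2 := hshift (-h)
  have hint2 := hint (-h)
  simp only [← sub_eq_add_neg] at h2 hint2
  rw [hshift, h2, ← integral_sub (hint h) hint2]
  simp only [Lop, mul_sub]

/-- A quantitative lower bound for the convolution of the Whitham kernel with an odd periodic
function that is nonnegative on the left half-period. -/
theorem le_Lop_whithamKernel {P M h : ℝ} (hP : 1 ≤ P) (hh : 0 < h) (hh' : h ≤ 1 / 16)
    {D : ℝ → ℝ}
    (hD : Continuous D) (hper : Function.Periodic D P) (hodd : ∀ t, D (-t) = -D t)
    (hM : ∀ t, |D t| ≤ M) (hpos : ∀ t ∈ Set.Icc (-(P / 2)) 0, 0 ≤ D t) :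
    (∫ y in (-(4 * h))..(-(2 * h)), D y) / (4608 * Real.sqrt h) ≤
      Lop whithamKernel D (-(3 * h)) := by
  set I := ∫ y in (-(4 * h))..(-(2 * h)), D y with hI
  set A := 1 / h with hA
  have hA16 : 16 ≤ A := by rw [hA, le_div_iff₀ hh]; linarith
  have hAh : A * h = 1 := by rw [hA]; field_simp
  have hx : -(3 * h) ∈ Set.Icc (-(P / 2)) 0 := ⟨by linarith, by linarith⟩
  have hI0 : 0 ≤ I := intervalIntegral.integral_nonneg (by linarith) fun y hy =>
    hpos y ⟨by linarith [hy.1], by linarith [hy.2]⟩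
  have hint := integrableOn_whithamDensity_mul_integral hD hM (-(3 * h))
  have hlow : A / 16 / Real.sqrt (2 * A) * (1 / 36 * I) ≤
      ∫ s in Set.Ioi 0, whithamDensity s * ∫ y, Real.exp (-s * |-(3 * h) - y|) * D y := by
    calc _ ≤ (∫ s in A..2 * A, (Real.sin (2 * s) ^ 2 - Real.sin (2 * s)) / 4) /
          Real.sqrt (2 * A) * (1 / 36 * I) := by
          gcongr
          exact le_integral_sin_sq_sub_sin (by linarith)
      _ = ∫ s in A..2 * A, (Real.sin (2 * s) ^ 2 - Real.sin (2 * s)) / 4 /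
          Real.sqrt (2 * A) * (1 / 36 * I) := by
          rw [← intervalIntegral.integral_div, ← intervalIntegral.integral_mul_const]
      _ ≤ ∫ s in A..2 * A, whithamDensity s * ∫ y, Real.exp (-s * |-(3 * h) - y|) * D y := by
          refine intervalIntegral.integral_mono_on (by linarith)
            (Continuous.intervalIntegrable (by fun_prop) _ _) ?_ fun s hs => ?_
          · rw [intervalIntegrable_iff_integrableOn_Ioc_of_le (by linarith)]
            exact hint.mono_set fun s hs => lt_trans (by linarith) hs.1
          · have hsh : s * h ∈ Set.Icc (1 : ℝ) 2 := ⟨by nlinarith [hs.1], by nlinarith [hs.2]⟩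
            calc _ ≤ whithamDensity s * (1 / 36 * I) := by
                  gcongr
                  exact le_whithamDensity (by linarith [hs.1]) hs.2
              _ ≤ _ := by
                  refine mul_le_mul_of_nonneg_left ?_ (whithamDensity_nonneg s)
                  exact le_integral_exp_abs_mul hP hh hh' hsh hD hper hodd hM hpos
      _ ≤ _ := by
          rw [intervalIntegral.integral_of_le (by linarith)]
          refine setIntegral_mono_set hint ?_
            (LE.le.eventuallyLE fun s hs => lt_trans (by linarith) hs.1)
          refine (ae_restrict_iff' measurableSet_Ioi).2 (ae_of_all _ fun s hs => ?_)
          exact mul_nonneg (whithamDensity_nonneg s)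
            (integral_exp_abs_mul_nonneg hs (by linarith) hD hper hodd hM hpos hx)
  rw [Lop_whithamKernel_eq hD hM]
  have hsq : 0 < Real.sqrt h := Real.sqrt_pos.2 hh
  have hconst : 1 / (4608 * Real.sqrt h) ≤ 1 / π * (A / 16 / Real.sqrt (2 * A) * (1 / 36)) := by
    have h1 : Real.sqrt (2 * A) * Real.sqrt h = Real.sqrt 2 := by
      rw [← Real.sqrt_mul (by linarith), mul_assoc, hAh, mul_one]
    have h2 : A / Real.sqrt (2 * A) = Real.sqrt (2 * A) / 2 := by
      have := Real.sq_sqrt (show 0 ≤ 2 * A by linarith)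
      rw [div_eq_div_iff (by positivity) two_ne_zero]
      linarith
    have h3 : 1 ≤ Real.sqrt 2 := Real.one_le_sqrt.2 one_le_two
    rw [div_right_comm, h2, div_le_iff₀ (by positivity)]
    calc (1 : ℝ) ≤ 4 * Real.sqrt 2 / π := by
          rw [le_div_iff₀ Real.pi_pos]
          linarith [Real.pi_lt_four]
      _ = _ := by
          rw [← h1]
          ring
  calc I / (4608 * Real.sqrt h) = 1 / (4608 * Real.sqrt h) * I := by ring
    _ ≤ 1 / π * (A / 16 / Real.sqrt (2 * A) * (1 / 36)) * I := by gcongr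
    _ = 1 / π * (A / 16 / Real.sqrt (2 * A) * (1 / 36 * I)) := by ring
    _ ≤ _ := by gcongr

/-- Monotonicity on half a period passes to central differences of an even periodic function. -/
theorem le_add_of_even_of_periodic {φ : ℝ → ℝ} {P h y : ℝ}
    (hmono : MonotoneOn φ (Set.Icc (-(P / 2)) 0)) (heven : ∀ x, φ (-x) = φ x) (hper : Function.Periodic φ P) (hh : 0 ≤ h) (hhP : 2 * h ≤ P)
    (hy : y ∈ Set.Icc (-(P / 2)) 0) : φ (y - h) ≤ φ (y + h) := by
  obtain ⟨hy1, hy2⟩ := hy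
  have ha : ∃ a ∈ Set.Icc (-(P / 2)) 0, φ a = φ (y - h) ∧ a ≤ y + h ∧ a ≤ -(y + h) := by
    rcases le_total (-(P / 2)) (y - h) with h1 | h1
    · exact ⟨y - h, ⟨h1, by linarith⟩, rfl, by linarith, by linarith⟩
    · refine ⟨-(y - h + P), ⟨by linarith, by linarith⟩, ?_, by linarith, by linarith⟩
      rw [heven, hper]
  obtain ⟨a, ha, haeq, ha1, ha2⟩ := ha
  rw [← haeq]
  rcases le_total (y + h) 0 with h1 | h1
  · exact hmono ha ⟨by linarith, h1⟩ ha1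
  · rw [← heven (y + h)]
    exact hmono ha ⟨by linarith, by linarith⟩ ha2

theorem mul_sub_le_integral_central_difference {φ : ℝ → ℝ} {h : ℝ} (hφ : Continuous φ)
    (hh : 0 ≤ h) (hmono : MonotoneOn φ (Set.Icc (-(5 * h)) 0)) :
    h * (φ (-(2 * h)) - φ (-(4 * h))) ≤
      ∫ y in (-(4 * h))..(-(2 * h)), (φ (y + h) - φ (y - h)) := by
  have hint : ∀ a b : ℝ, IntervalIntegrable (fun y => φ (y + h) - φ (y - h)) volume a b :=
    fun a b => Continuous.intervalIntegrable (by fun_prop) a b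
  have key : ∀ k : ℝ, 3 ≤ k → k ≤ 4 → h * (φ (-((k - 1) * h)) - φ (-(k * h))) ≤
      ∫ y in (-(k * h))..(-((k - 1) * h)), (φ (y + h) - φ (y - h)) := fun k hk3 hk4 => by
    have hc : h * (φ (-((k - 1) * h)) - φ (-(k * h))) =
        ∫ _ in (-(k * h))..(-((k - 1) * h)), (φ (-((k - 1) * h)) - φ (-(k * h))) := by
      rw [intervalIntegral.integral_const, smul_eq_mul]
      ring
    rw [hc]
    refine intervalIntegral.integral_mono_on (by nlinarith) (by simp) (hint _ _) fun y hy => ?_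
    obtain ⟨hy1, hy2⟩ := hy
    have h1 : φ (-((k - 1) * h)) ≤ φ (y + h) :=
      hmono ⟨by nlinarith, by nlinarith⟩ ⟨by nlinarith, by nlinarith⟩ (by nlinarith)
    have h2 : φ (y - h) ≤ φ (-(k * h)) :=
      hmono ⟨by nlinarith, by nlinarith⟩ ⟨by nlinarith, by nlinarith⟩ (by nlinarith)
    linarith
  have k4 := key 4 (by norm_num) le_rfl
  have k3 := key 3 le_rfl (by norm_num)
  norm_num at k4 k3
  rw [← intervalIntegral.integral_add_adjacent_intervals (hint _ (-(3 * h))) (hint _ _)]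
  linarith

theorem uniform_cusp_estimate :
    ∃ δ : ℝ, 0 < δ ∧
      ∀ (P : ℝ), 1 ≤ P →
      ∀ lam ∈ Set.Ioc (0:ℝ) 1, ∀ μ ∈ Set.Ioc (0:ℝ) 1,
      ∀ φ : ℝ → ℝ,
        Continuous φ →
        Function.Periodic φ P →
        (∀ x : ℝ, -μ * φ x + Lop whithamKernel φ x + (φ x) ^ 2 = 0) →
        (∀ x : ℝ, φ (-x) = φ x) →
        StrictMonoOn φ (Set.Ioo (-(P / 2)) 0) →
        ContDiffOn ℝ (⊤ : ℕ∞) φ {x : ℝ | ¬ ∃ n : ℤ, x = n * P} →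
        (∀ x : ℝ, μ - 1 ≤ φ x ∧ φ x ≤ φ 0) →
        φ 0 = lam * μ / 2 →
        ∀ x : ℝ, |x| ≤ δ → δ * |x| ^ (1 / 2 : ℝ) ≤ μ / 2 - φ x := by
  refine ⟨1 / 18432, by norm_num, ?_⟩
  intro P hP lam hlam μ hμ φ hφ hper hsol heven hmono _ hbd h0 x hx
  have hle : ∀ t, φ t ≤ μ / 2 := fun t => by nlinarith [(hbd t).2, hlam.2, hμ.1]
  rcases eq_or_ne x 0 with rfl | hx0
  · simpa using hle 0
  obtain ⟨h, hh, hxh⟩ : ∃ h : ℝ, 0 < h ∧ |x| = 4 * h :=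
    ⟨|x| / 4, by positivity, by ring⟩
  have hh' : h ≤ 1 / 16 := by linarith
  have hmono' : MonotoneOn φ (Set.Icc (-(P / 2)) 0) := by
    rw [← Set.Ioc_insert_left (by linarith), ← Set.Ioo_insert_right (by linarith)]
    have hcluster : ∀ t ∈ Set.Icc (-(P / 2)) 0, ClusterPt t (𝓟 (Set.Ioo (-(P / 2)) 0)) :=
      fun t ht => mem_closure_iff_clusterPt.1 (by rwa [closure_Ioo (by linarith)])
    refine (hmono.monotoneOn.insert_of_continuousWithinAt
      (hcluster 0 ⟨by linarith, le_rfl⟩) hφ.continuousWithinAt).insert_of_continuousWithinAt ?_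
      hφ.continuousWithinAt
    exact (hcluster _ ⟨le_rfl, by linarith⟩).mono (principal_mono.2 (Set.subset_insert _ _))
  have hM : ∀ t, |φ t| ≤ 1 := fun t =>
    abs_le.2 ⟨by linarith [(hbd t).1, hμ.1], by linarith [hle t, hμ.2]⟩
  have hL := le_Lop_whithamKernel hP hh hh' (D := fun y => φ (y + h) - φ (y - h)) (M := 1 + 1)
    (by fun_prop)
    (fun t => by
      simp only [add_right_comm t P h, show t + P - h = t - h + P by ring, hper _])
    (fun t => by
      rw [← heven (-t + h), ← heven (-t - h), show -(-t + h) = t - h by ring,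
        show -(-t - h) = t + h by ring, neg_sub])
    (fun t => (abs_sub _ _).trans (add_le_add (hM _) (hM _)))
    (fun t ht => sub_nonneg.2
      (le_add_of_even_of_periodic hmono' heven hper hh.le (by linarith) ht))
  rw [← Lop_whithamKernel_sub hφ hM, show -(3 * h) + h = -(2 * h) by ring,
    show -(3 * h) - h = -(4 * h) by ring] at hL
  have hI := mul_sub_le_integral_central_difference hφ hh.le
    (hmono'.mono (Set.Icc_subset_Icc_left (by linarith)))
  have hΔ : φ (-(4 * h)) < φ (-(2 * h)) :=
    hmono ⟨by linarith, by linarith⟩ ⟨by linarith, by linarith⟩ (by linarith)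
  have hφx : φ x = φ (-(4 * h)) := by
    rw [← hxh]
    rcases abs_choice x with h | h <;> simp [h, heven]
  have hsq : 0 < Real.sqrt h := Real.sqrt_pos.2 hh
  have hsqx : |x| ^ (1 / 2 : ℝ) = 2 * Real.sqrt h := by
    rw [← Real.sqrt_eq_rpow, hxh, show (4 : ℝ) * h = 2 ^ 2 * h by norm_num,
      Real.sqrt_mul (by norm_num), Real.sqrt_sq zero_le_two]
  rw [hφx, hsqx]
  rw [div_le_iff₀ (by positivity)] at hL
  have hprod := hI.trans hL
  have hsol4 := hsol (-(4 * h))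
  have hsol2 := hsol (-(2 * h))
  set r := Real.sqrt h with hr
  have hrr : r * r = h := Real.mul_self_sqrt hh.le
  set a := φ (-(4 * h))
  set b := φ (-(2 * h))
  have hquad : Lop whithamKernel φ (-(2 * h)) - Lop whithamKernel φ (-(4 * h)) ≤
      (b - a) * (2 * (μ / 2 - a)) := by nlinarith
  have hcancel : r ≤ 4608 * (2 * (μ / 2 - a)) := by
    have hpos : 0 < (b - a) * r := mul_pos (sub_pos.2 hΔ) hsq
    refine le_of_mul_le_mul_left ?_ hpos
    calc (b - a) * r * r = h * (b - a) := by rw [← hrr]; ring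
      _ ≤ _ := hprod
      _ ≤ (b - a) * (2 * (μ / 2 - a)) * (4608 * r) := by gcongr
      _ = _ := by ring
  linarith
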